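/- Assume additionally that the function x ↦ (|A|_∞(x) + |C|_∞(x)² Φ_A(x)⁻¹)/(1+‖x‖²) + ‖B̄(x)‖/(1+‖x‖) is μ-integrable. Let h : ℝ^d → ℝ be a bounded C¹ function satisfying the weak resolvent identity, and let K > 0. Then for every integer n ≥ 1 and every compactly supported Lipschitz u : ℝ^d → [0,1] with u = 1 on B_n, u = 0 outside B_{2n} and ‖∇u(x)‖ ≤ K/n for a.e. x, one has ∫_{B_n} h² dμ ≤ 16 d K² ‖h‖_∞² ∫_{B_{2n} \ B_n} |A|_∞/(1+‖x‖²) dμ + 16 d² K² ‖h‖_∞² ∫_{B_{2n} \ B_n} |C|_∞² Φ_A⁻¹/(1+‖x‖²) dμ + 4 K ‖h‖_∞² ∫_{B_{2n} \ B_n} ‖B̄‖/(1+‖x‖) dμ, where ‖h‖_∞ := sup_{ℝ^d} |h|. -/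

import Mathlib

open MeasureTheory Real
open scoped RealInnerProductSpace ENNReal

noncomputable section

/-- `⟨M v, w⟩` for a `d × d` matrix `M` and vectors `v, w ∈ ℝ^d`. -/
def mdot {d : ℕ} (M : Matrix (Fin d) (Fin d) ℝ) (v w : EuclideanSpace ℝ (Fin d)) : ℝ :=
  ∑ i, ∑ j, M i j * v j * w i

/-- `|M|_∞ = max_{i,j} |m_ij|`. -/
def matSup {d : ℕ} (M : Matrix (Fin d) (Fin d) ℝ) : ℝ :=
  ⨆ i, ⨆ j, |M i j|

/-- `Φ_M = inf_{ξ ≠ 0} ⟨M ξ, ξ⟩ / ‖ξ‖²`. -/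
def PhiA {d : ℕ} (M : Matrix (Fin d) (Fin d) ℝ) : ℝ :=
  ⨅ ξ : {ξ : EuclideanSpace ℝ (Fin d) // ξ ≠ 0}, mdot M ξ.1 ξ.1 / ‖ξ.1‖ ^ 2

/-- `h` satisfies the weak resolvent identity:
`(1/2)∫ ⟨(A+C)∇u, ∇h⟩ dμ + ∫ ⟨B̄, ∇u⟩ h dμ + ∫ u h dμ = 0` for every compactly supported
Lipschitz `u`. -/
def WeakResolvent {d : ℕ} (μ : Measure (EuclideanSpace ℝ (Fin d)))
    (A C : EuclideanSpace ℝ (Fin d) → Matrix (Fin d) (Fin d) ℝ)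
    (Bb : EuclideanSpace ℝ (Fin d) → EuclideanSpace ℝ (Fin d))
    (h : EuclideanSpace ℝ (Fin d) → ℝ) : Prop :=
  ∀ u : EuclideanSpace ℝ (Fin d) → ℝ,
    (∃ K, LipschitzWith K u) → HasCompactSupport u →
    (1/2) * (∫ x, mdot (A x + C x) (gradient u x) (gradient h x) ∂μ)
      + (∫ x, ⟪Bb x, gradient u x⟫ * h x ∂μ)
      + (∫ x, u x * h x ∂μ) = 0


section LinearAlgebra

variable {d : ℕ}

lemma mdot_add_left (M : Matrix (Fin d) (Fin d) ℝ) (v v' w : EuclideanSpace ℝ (Fin d)) :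
    mdot M (v + v') w = mdot M v w + mdot M v' w := by
  simp only [mdot, PiLp.add_apply, mul_add, add_mul, Finset.sum_add_distrib]

lemma mdot_smul_left (M : Matrix (Fin d) (Fin d) ℝ) (c : ℝ) (v w : EuclideanSpace ℝ (Fin d)) :
    mdot M (c • v) w = c * mdot M v w := by
  simp only [mdot, PiLp.smul_apply, smul_eq_mul, Finset.mul_sum]
  exact Finset.sum_congr rfl fun i _ => Finset.sum_congr rfl fun j _ => by ring

lemma mdot_transpose (M : Matrix (Fin d) (Fin d) ℝ) (v w : EuclideanSpace ℝ (Fin d)) :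
    mdot M.transpose v w = mdot M w v := by
  simp only [mdot, Matrix.transpose_apply]
  rw [Finset.sum_comm]
  exact Finset.sum_congr rfl fun i _ => Finset.sum_congr rfl fun j _ => by ring

lemma mdot_add_right (M : Matrix (Fin d) (Fin d) ℝ) (v w w' : EuclideanSpace ℝ (Fin d)) :
    mdot M v (w + w') = mdot M v w + mdot M v w' := by
  simp only [← mdot_transpose M _ v, mdot_add_left]

lemma mdot_smul_right (M : Matrix (Fin d) (Fin d) ℝ) (c : ℝ) (v w : EuclideanSpace ℝ (Fin d)) :
    mdot M v (c • w) = c * mdot M v w := by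
  simp only [← mdot_transpose M _ v, mdot_smul_left]

lemma add_mdot (M N : Matrix (Fin d) (Fin d) ℝ) (v w : EuclideanSpace ℝ (Fin d)) :
    mdot (M + N) v w = mdot M v w + mdot N v w := by
  simp only [mdot, Matrix.add_apply, add_mul, Finset.sum_add_distrib]

lemma neg_mdot (M : Matrix (Fin d) (Fin d) ℝ) (v w : EuclideanSpace ℝ (Fin d)) :
    mdot (-M) v w = -mdot M v w := by
  simp only [mdot, Matrix.neg_apply, neg_mul, Finset.sum_neg_distrib]

lemma mdot_self_eq_zero_of_transpose_eq_neg {M : Matrix (Fin d) (Fin d) ℝ}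
    (hM : M.transpose = -M) (v : EuclideanSpace ℝ (Fin d)) : mdot M v v = 0 := by
  have := mdot_transpose M v v
  rw [hM, neg_mdot] at this
  linarith

lemma abs_le_matSup (M : Matrix (Fin d) (Fin d) ℝ) (i j : Fin d) : |M i j| ≤ matSup M :=
  (le_ciSup (f := fun j => |M i j|) (Set.finite_range _).bddAbove j).trans
    (le_ciSup (f := fun i => ⨆ j, |M i j|) (Set.finite_range _).bddAbove i)

lemma matSup_nonneg (M : Matrix (Fin d) (Fin d) ℝ) : 0 ≤ matSup M :=
  Real.iSup_nonneg fun _ => Real.iSup_nonneg fun _ => abs_nonneg _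

lemma sq_sum_abs_le (v : EuclideanSpace ℝ (Fin d)) : (∑ i, |v i|) ^ 2 ≤ d * ‖v‖ ^ 2 := by
  have := sq_sum_le_card_mul_sum_sq (s := Finset.univ) (f := fun i => |v i|)
  simpa [EuclideanSpace.norm_sq_eq] using this

lemma abs_mdot_le (M : Matrix (Fin d) (Fin d) ℝ) (v w : EuclideanSpace ℝ (Fin d)) :
    |mdot M v w| ≤ d * matSup M * (‖v‖ * ‖w‖) := by
  have h₁ : |mdot M v w| ≤ matSup M * ((∑ i, |v i|) * ∑ i, |w i|) := by
    rw [mul_comm (∑ i, |v i|), Finset.sum_mul_sum, Finset.mul_sum]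
    refine (Finset.abs_sum_le_sum_abs _ _).trans (Finset.sum_le_sum fun i _ => ?_)
    rw [Finset.mul_sum]
    refine (Finset.abs_sum_le_sum_abs _ _).trans (Finset.sum_le_sum fun j _ => ?_)
    rw [abs_mul, abs_mul, mul_assoc, mul_comm |w i|]
    exact mul_le_mul_of_nonneg_right (abs_le_matSup M i j) (by positivity)
  have h₂ : (∑ i, |v i|) * ∑ i, |w i| ≤ d * (‖v‖ * ‖w‖) := by
    refine _root_.le_of_sq_le_sq ?_ (by positivity)
    calc ((∑ i, |v i|) * ∑ i, |w i|) ^ 2 = (∑ i, |v i|) ^ 2 * (∑ i, |w i|) ^ 2 := mul_pow _ _ _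
      _ ≤ (d * ‖v‖ ^ 2) * (d * ‖w‖ ^ 2) := by
        gcongr <;> exact sq_sum_abs_le _
      _ = (d * (‖v‖ * ‖w‖)) ^ 2 := by ring
  calc |mdot M v w| ≤ matSup M * (d * (‖v‖ * ‖w‖)) :=
        h₁.trans (mul_le_mul_of_nonneg_left h₂ (matSup_nonneg M))
    _ = _ := by ring

lemma mdot_self_pos {M : Matrix (Fin d) (Fin d) ℝ} (hM : M.PosDef)
    {v : EuclideanSpace ℝ (Fin d)} (hv : v ≠ 0) : 0 < mdot M v v := by
  have := hM.dotProduct_mulVec_pos (x := v.ofLp) (by simpa using hv)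
  refine this.trans_eq ?_
  simp only [mdot, dotProduct, Matrix.mulVec, Finset.mul_sum, star_trivial]
  exact Finset.sum_congr rfl fun i _ => Finset.sum_congr rfl fun j _ => by ring

lemma mdot_self_nonneg {M : Matrix (Fin d) (Fin d) ℝ} (hM : M.PosDef)
    (v : EuclideanSpace ℝ (Fin d)) : 0 ≤ mdot M v v := by
  rcases eq_or_ne v 0 with rfl | hv
  · simp [mdot]
  · exact (mdot_self_pos hM hv).le

lemma PhiA_nonneg {M : Matrix (Fin d) (Fin d) ℝ} (hM : M.PosDef) : 0 ≤ PhiA M :=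
  Real.iInf_nonneg fun _ => div_nonneg (mdot_self_nonneg hM _) (sq_nonneg _)

lemma PhiA_mul_norm_sq_le {M : Matrix (Fin d) (Fin d) ℝ} (hM : M.PosDef)
    (v : EuclideanSpace ℝ (Fin d)) : PhiA M * ‖v‖ ^ 2 ≤ mdot M v v := by
  rcases eq_or_ne v 0 with rfl | hv
  · simp [mdot]
  · rw [← le_div_iff₀ (by positivity)]
    exact ciInf_le (f := fun ξ : {ξ : EuclideanSpace ℝ (Fin d) // ξ ≠ 0} =>
      mdot M ξ.1 ξ.1 / ‖ξ.1‖ ^ 2) ⟨0, by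
        rintro _ ⟨ξ, rfl⟩
        exact div_nonneg (mdot_self_nonneg hM _) (sq_nonneg _)⟩ ⟨v, hv⟩

lemma PhiA_pos [NeZero d] {M : Matrix (Fin d) (Fin d) ℝ} (hM : M.PosDef) : 0 < PhiA M := by
  have hcont : Continuous fun v : EuclideanSpace ℝ (Fin d) => mdot M v v := by
    unfold mdot; fun_prop
  have hne : (Metric.sphere (0 : EuclideanSpace ℝ (Fin d)) 1).Nonempty :=
    NormedSpace.sphere_nonempty.2 zero_le_one
  obtain ⟨e, he, hmin⟩ := (isCompact_sphere (0 : EuclideanSpace ℝ (Fin d)) 1).exists_isMinOn hne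
    hcont.continuousOn
  have he1 : ‖e‖ = 1 := by simpa using he
  have he0 : e ≠ 0 := fun h => by simp [h] at he1
  have : Nonempty {ξ : EuclideanSpace ℝ (Fin d) // ξ ≠ 0} := ⟨⟨e, he0⟩⟩
  refine (mdot_self_pos hM he0).trans_le (le_ciInf fun ξ => ?_)
  have hξ : ‖ξ.1‖ ≠ 0 := norm_ne_zero_iff.2 ξ.2
  have := isMinOn_iff.1 hmin (‖ξ.1‖⁻¹ • ξ.1) (by simp [norm_smul, hξ])
  rw [mdot_smul_left, mdot_smul_right] at this
  refine this.trans_eq ?_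
  field_simp

lemma neg_half_mdot_le [NeZero d] {A C : Matrix (Fin d) (Fin d) ℝ} (hA : A.PosDef)
    (hAs : A.IsSymm) (hC : C.transpose = -C) (p q : EuclideanSpace ℝ (Fin d)) :
    -(1 / 2 * mdot (A + C) (q + (2 : ℝ) • p) q)
      ≤ (d * matSup A + d ^ 2 * (matSup C ^ 2 * (PhiA A)⁻¹)) * ‖p‖ ^ 2 := by
  have hΦ := PhiA_pos hA
  have hqq := PhiA_mul_norm_sq_le hA q
  have hpp := (le_abs_self _).trans (abs_mdot_le A p p)
  have hpq := (neg_le_abs _).trans (abs_mdot_le C p q)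
  have hsq := mdot_self_nonneg hA ((2 : ℝ) • p + q)
  have hsymm : mdot A q p = mdot A p q := by
    rw [← mdot_transpose, hAs.eq]
  have hCq := mdot_self_eq_zero_of_transpose_eq_neg hC q
  simp only [mdot_add_left, mdot_add_right, mdot_smul_left, mdot_smul_right, hsymm] at hsq
  simp only [add_mdot, mdot_add_left, mdot_smul_left, hCq]
  have hyoung : d * matSup C * (‖p‖ * ‖q‖)
      ≤ 1 / 4 * (PhiA A * ‖q‖ ^ 2) + d ^ 2 * (matSup C ^ 2 * (PhiA A)⁻¹) * ‖p‖ ^ 2 := by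
    have h₀ : 0 ≤ (PhiA A)⁻¹ * (1 / 2 * PhiA A * ‖q‖ - d * matSup C * ‖p‖) ^ 2 := by positivity
    have h₁ : (PhiA A)⁻¹ * (1 / 2 * PhiA A * ‖q‖ - d * matSup C * ‖p‖) ^ 2
        = 1 / 4 * (PhiA A * ‖q‖ ^ 2) + d ^ 2 * (matSup C ^ 2 * (PhiA A)⁻¹) * ‖p‖ ^ 2
          - d * matSup C * (‖p‖ * ‖q‖) := by
      field_simp
      ring
    linarith
  linarith

end LinearAlgebra
section Gradient

variable {d : ℕ}

lemma norm_gradient {E : Type*} [NormedAddCommGroup E] [InnerProductSpace ℝ E] [CompleteSpace E]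
    (f : E → ℝ) (x : E) : ‖gradient f x‖ = ‖fderiv ℝ f x‖ :=
  (InnerProductSpace.toDual ℝ E).symm.norm_map _

lemma measurable_gradient (f : EuclideanSpace ℝ (Fin d) → ℝ) : Measurable (gradient f) :=
  (InnerProductSpace.toDual ℝ _).symm.continuous.measurable.comp (measurable_fderiv ℝ f)

lemma ContDiff.continuous_gradient {f : EuclideanSpace ℝ (Fin d) → ℝ} (hf : ContDiff ℝ 1 f) :
    Continuous (gradient f) :=
  (InnerProductSpace.toDual ℝ _).symm.continuous.comp (hf.continuous_fderiv one_ne_zero)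

lemma gradient_eq_zero_of_notMem_tsupport {f : EuclideanSpace ℝ (Fin d) → ℝ}
    {x : EuclideanSpace ℝ (Fin d)} (hx : x ∉ tsupport f) : gradient f x = 0 := by
  rw [← norm_eq_zero, norm_gradient, norm_eq_zero]
  by_contra hne
  exact hx (support_fderiv_subset ℝ hne)

lemma gradient_eq_zero_of_fderiv_eq_zero {f : EuclideanSpace ℝ (Fin d) → ℝ}
    {x : EuclideanSpace ℝ (Fin d)} (hx : fderiv ℝ f x = 0) : gradient f x = 0 := by
  rw [← norm_eq_zero, norm_gradient, hx, norm_zero]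

lemma HasGradientAt.mul {f g : EuclideanSpace ℝ (Fin d) → ℝ}
    {f' g' x : EuclideanSpace ℝ (Fin d)} (hf : HasGradientAt f f' x) (hg : HasGradientAt g g' x) :
    HasGradientAt (fun y => f y * g y) (f x • g' + g x • f') x := by
  rw [hasGradientAt_iff_hasFDerivAt] at *
  simpa only [map_add, map_smul] using! hf.mul hg

lemma lipschitzWith_mul_of_bounded {α : Type*} [PseudoMetricSpace α] {f g : α → ℝ}
    {Kf Kg Mf Mg : NNReal} (hf : LipschitzWith Kf f) (hg : LipschitzWith Kg g)
    (hMf : ∀ x, |f x| ≤ Mf) (hMg : ∀ x, |g x| ≤ Mg) :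
    LipschitzWith (Mf * Kg + Mg * Kf) fun x => f x * g x := by
  refine LipschitzWith.of_dist_le_mul fun x y => ?_
  have h₁ := hf.dist_le_mul x y
  have h₂ := hg.dist_le_mul x y
  rw [Real.dist_eq] at *
  calc |f x * g x - f y * g y| = |f x * (g x - g y) + g y * (f x - f y)| := by ring_nf
    _ ≤ |f x| * |g x - g y| + |g y| * |f x - f y| := by
      simpa only [abs_mul] using abs_add_le (f x * (g x - g y)) (g y * (f x - f y))
    _ ≤ Mf * (Kg * dist x y) + Mg * (Kf * dist x y) := by
      gcongr
      exacts [hMf x, hMg y]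
    _ = _ := by push_cast; ring

lemma exists_lipschitzWith_mul_contDiff {f g : EuclideanSpace ℝ (Fin d) → ℝ}
    (hf : ∃ K, LipschitzWith K f) (hfs : HasCompactSupport f) (hg : ContDiff ℝ 1 g) :
    ∃ K, LipschitzWith K fun x => f x * g x := by
  obtain ⟨Kf, hf⟩ := hf
  obtain ⟨R, hR, hsub⟩ := hfs.isCompact.isBounded.subset_closedBall_lt 0 0
  let φ : ContDiffBump (0 : EuclideanSpace ℝ (Fin d)) := ⟨R, R + 1, hR, by linarith⟩
  have hφg : ContDiff ℝ 1 fun x => φ x * g x := φ.contDiff.mul hg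
  have hφgs : HasCompactSupport fun x => φ x * g x := φ.hasCompactSupport.mul_right
  obtain ⟨Kg, hgL⟩ : ∃ K, LipschitzWith K fun x => φ x * g x :=
    ⟨_, hφg.lipschitzWith_of_hasCompactSupport hφgs one_ne_zero |>.choose_spec⟩
  obtain ⟨Mf, hMf⟩ := hfs.exists_bound_of_continuous hf.continuous
  obtain ⟨Mg, hMg⟩ := hφgs.exists_bound_of_continuous hφg.continuous
  have heq : (fun x => f x * g x) = fun x => f x * (φ x * g x) := by
    funext x
    by_cases hx : x ∈ tsupport f
    · rw [φ.one_of_mem_closedBall (hsub hx), one_mul]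
    · simp [image_eq_zero_of_notMem_tsupport hx]
  rw [heq]
  exact ⟨_, lipschitzWith_mul_of_bounded (Mf := Mf.toNNReal) (Mg := Mg.toNNReal) hf hgL
    (fun x => (hMf x).trans (Real.le_coe_toNNReal _))
    (fun x => (hMg x).trans (Real.le_coe_toNNReal _))⟩

end Gradient

section Integrability

variable {d : ℕ} {μ : Measure (EuclideanSpace ℝ (Fin d))}

lemma MeasureTheory.LocallyIntegrable.integrable_of_abs_le {X : Type*} [TopologicalSpace X]
    [MeasurableSpace X] {ν : Measure X} {f g : X → ℝ} {s : Set X}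
    (hg : LocallyIntegrable g ν) (hs : IsCompact s) (hf : AEStronglyMeasurable f ν)
    (hfs : ∀ x ∉ s, f x = 0) {c : ℝ} (hfg : ∀ x, |f x| ≤ c * |g x|) : Integrable f ν := by
  rw [← integrableOn_iff_integrable_of_support_subset (s := s)
    fun x hx => by_contra fun hxs => hx (hfs x hxs)]
  exact ((hg.integrableOn_isCompact hs).abs.const_mul c).mono' hf.restrict
    (Filter.Eventually.of_forall hfg)

lemma norm_gradient_le {f : EuclideanSpace ℝ (Fin d) → ℝ} {K : NNReal} (hf : LipschitzWith K f)
    (x : EuclideanSpace ℝ (Fin d)) : ‖gradient f x‖ ≤ K :=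
  (norm_gradient f x).trans_le (norm_fderiv_le_of_lipschitz ℝ hf)

lemma integrable_mdot_gradient [IsLocallyFiniteMeasure μ]
    {M : EuclideanSpace ℝ (Fin d) → Matrix (Fin d) (Fin d) ℝ}
    (hM : ∀ i j, Continuous fun x => M x i j) {v h : EuclideanSpace ℝ (Fin d) → ℝ}
    (hv : ∃ K, LipschitzWith K v) (hvs : HasCompactSupport v) (hh : ContDiff ℝ 1 h) :
    Integrable (fun x => mdot (M x) (gradient v x) (gradient h x)) μ := by
  obtain ⟨K, hv⟩ := hv
  have hgh := hh.continuous_gradient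
  have hgv := measurable_gradient v
  refine integrable_finsetSum _ fun i _ => integrable_finsetSum _ fun j _ => ?_
  have hc : Continuous fun x => M x i j * gradient h x i := by
    have := hM i j
    fun_prop
  have hmv : Measurable fun x => gradient v x j := by fun_prop
  have hmh : Measurable fun x => gradient h x i := by fun_prop
  refine (hc.locallyIntegrable (μ := μ)).integrable_of_abs_le (c := K) hvs.isCompact
    (((hM i j).measurable.mul hmv).mul hmh).aestronglyMeasurable
    (fun x hx => by simp [gradient_eq_zero_of_notMem_tsupport hx]) fun x => ?_
  rw [mul_right_comm, abs_mul, mul_comm]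
  gcongr
  exact (PiLp.norm_apply_le (gradient v x) j).trans (norm_gradient_le hv x)

lemma integrable_inner_gradient_mul
    {B : EuclideanSpace ℝ (Fin d) → EuclideanSpace ℝ (Fin d)} (hB : Measurable B)
    (hBloc : LocallyIntegrable (fun x => ‖B x‖) μ) {v h : EuclideanSpace ℝ (Fin d) → ℝ}
    (hv : ∃ K, LipschitzWith K v) (hvs : HasCompactSupport v) (hh : Continuous h)
    {S : ℝ} (hS : ∀ x, |h x| ≤ S) :
    Integrable (fun x => ⟪B x, gradient v x⟫ * h x) μ := by
  obtain ⟨K, hv⟩ := hv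
  refine hBloc.integrable_of_abs_le (c := K * S) hvs.isCompact
    ((hB.inner (measurable_gradient v)).mul hh.measurable).aestronglyMeasurable
    (fun x hx => by simp [gradient_eq_zero_of_notMem_tsupport hx]) fun x => ?_
  rw [abs_mul, abs_norm]
  calc |⟪B x, gradient v x⟫| * |h x| ≤ (‖B x‖ * K) * S := by
        gcongr
        · exact (abs_real_inner_le_norm _ _).trans
            (mul_le_mul_of_nonneg_left (norm_gradient_le hv x) (norm_nonneg _))
        · exact hS x
    _ = _ := by ring

end Integrability
lemma sq_div_le_of_norm_lt {K r n : ℝ} (hn : 1 ≤ n) (hr₀ : 0 ≤ r) (hr : r < 2 * n) :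
    (K / n) ^ 2 ≤ 16 * K ^ 2 / (1 + r ^ 2) := by
  rw [div_pow, div_le_div_iff₀ (by positivity) (by positivity)]
  have : 1 + r ^ 2 ≤ 16 * n ^ 2 := by nlinarith
  nlinarith [mul_le_mul_of_nonneg_left this (sq_nonneg K)]

lemma div_le_of_norm_lt {K r n : ℝ} (hK : 0 ≤ K) (hn : 1 ≤ n) (hr₀ : 0 ≤ r) (hr : r < 2 * n) :
    K / n ≤ 4 * K / (1 + r) := by
  rw [div_le_div_iff₀ (by positivity) (by positivity)]
  nlinarith [mul_le_mul_of_nonneg_left (show 1 + r ≤ 4 * n by linarith) hK]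

lemma gradient_eq_zero_of_mem_Icc {d : ℕ} {u : EuclideanSpace ℝ (Fin d) → ℝ}
    (hu : ∀ x, 0 ≤ u x ∧ u x ≤ 1) {x : EuclideanSpace ℝ (Fin d)} (hx : u x = 0 ∨ u x = 1) :
    gradient u x = 0 := by
  apply gradient_eq_zero_of_fderiv_eq_zero
  rcases hx with hx | hx
  · exact IsLocalMin.fderiv_eq_zero (Filter.Eventually.of_forall fun y => hx ▸ (hu y).1)
  · exact IsLocalMax.fderiv_eq_zero (Filter.Eventually.of_forall fun y => hx ▸ (hu y).2)

/-- The annulus estimate in the proof of Theorem 3.1(ii):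
`∫_{B_n} h² dμ ≤ 16dK²‖h‖_∞² ∫_{B_{2n}\B_n} |A|_∞/(1+‖x‖²) dμ
  + 16d²K²‖h‖_∞² ∫_{B_{2n}\B_n} |C|_∞²Φ_A⁻¹/(1+‖x‖²) dμ
  + 4K‖h‖_∞² ∫_{B_{2n}\B_n} ‖B̄‖/(1+‖x‖) dμ`. -/
theorem stmt9 {d : ℕ} (hd : 2 ≤ d)
    (ρ : EuclideanSpace ℝ (Fin d) → ℝ) (hρc : Continuous ρ) (hρ : ∀ x, 0 < ρ x)
    (μ : Measure (EuclideanSpace ℝ (Fin d)))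
    (hμ : μ = volume.withDensity fun x => ENNReal.ofReal (ρ x))
    (A C : EuclideanSpace ℝ (Fin d) → Matrix (Fin d) (Fin d) ℝ)
    (hAc : ∀ i j, Continuous fun x => A x i j)
    (hAsymm : ∀ x, (A x).IsSymm) (hApos : ∀ x, (A x).PosDef)
    (hCc : ∀ i j, Continuous fun x => C x i j)
    (hCanti : ∀ x, (C x).transpose = -(C x))
    (Bb : EuclideanSpace ℝ (Fin d) → EuclideanSpace ℝ (Fin d))
    (hBmeas : Measurable Bb)
    (hBloc : LocallyIntegrable (fun x => ‖Bb x‖) μ)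
    (hBdiv : ∀ f : EuclideanSpace ℝ (Fin d) → ℝ, (∃ K, LipschitzWith K f) →
      HasCompactSupport f → ∫ x, ⟪Bb x, gradient f x⟫ ∂μ = 0)
    (hint : Integrable (fun x =>
      (matSup (A x) + matSup (C x) ^ 2 * (PhiA (A x))⁻¹) / (1 + ‖x‖ ^ 2)
        + ‖Bb x‖ / (1 + ‖x‖)) μ)
    (h : EuclideanSpace ℝ (Fin d) → ℝ) (hh1 : ContDiff ℝ 1 h)
    (hhb : ∃ M, ∀ x, |h x| ≤ M)
    (hres : WeakResolvent μ A C Bb h)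
    (K : ℝ) (hK : 0 < K) :
    ∀ n : ℕ, 1 ≤ n →
    ∀ u : EuclideanSpace ℝ (Fin d) → ℝ,
      (∃ K', LipschitzWith K' u) → HasCompactSupport u →
      (∀ x, 0 ≤ u x ∧ u x ≤ 1) →
      (∀ x ∈ Metric.ball (0 : EuclideanSpace ℝ (Fin d)) (n : ℝ), u x = 1) →
      (∀ x ∉ Metric.ball (0 : EuclideanSpace ℝ (Fin d)) (2 * n : ℝ), u x = 0) →
      (∀ᵐ x ∂(volume : Measure (EuclideanSpace ℝ (Fin d))), ‖gradient u x‖ ≤ K / n) →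
      ∫ x in Metric.ball (0 : EuclideanSpace ℝ (Fin d)) (n : ℝ), h x ^ 2 ∂μ
        ≤ 16 * d * K ^ 2 * (⨆ y, |h y|) ^ 2 *
            ∫ x in Metric.ball (0 : EuclideanSpace ℝ (Fin d)) (2 * n : ℝ)
                \ Metric.ball (0 : EuclideanSpace ℝ (Fin d)) (n : ℝ),
              matSup (A x) / (1 + ‖x‖ ^ 2) ∂μ
          + 16 * d ^ 2 * K ^ 2 * (⨆ y, |h y|) ^ 2 *
            ∫ x in Metric.ball (0 : EuclideanSpace ℝ (Fin d)) (2 * n : ℝ)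
                \ Metric.ball (0 : EuclideanSpace ℝ (Fin d)) (n : ℝ),
              matSup (C x) ^ 2 * (PhiA (A x))⁻¹ / (1 + ‖x‖ ^ 2) ∂μ
          + 4 * K * (⨆ y, |h y|) ^ 2 *
            ∫ x in Metric.ball (0 : EuclideanSpace ℝ (Fin d)) (2 * n : ℝ)
                \ Metric.ball (0 : EuclideanSpace ℝ (Fin d)) (n : ℝ),
              ‖Bb x‖ / (1 + ‖x‖) ∂μ := by
  intro n hn u huL hus hu01 hu1 hu0 huK
  have : NeZero d := ⟨by omega⟩
  have : IsLocallyFiniteMeasure μ := hμ ▸ IsLocallyFiniteMeasure.withDensity_ofReal hρc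
  have hac : μ ≪ volume := hμ ▸ withDensity_absolutelyContinuous _ _
  have hn1 : (1 : ℝ) ≤ n := by exact_mod_cast hn
  set S : ℝ := ⨆ y, |h y|
  have hS : ∀ x, |h x| ≤ S := by
    obtain ⟨M, hM⟩ := hhb
    exact le_ciSup ⟨M, by rintro _ ⟨x, rfl⟩; exact hM x⟩
  have hSsq : ∀ x, h x ^ 2 ≤ S ^ 2 := fun x => sq_le_sq' (abs_le.1 (hS x)).1 (abs_le.1 (hS x)).2
  set D := Metric.ball (0 : EuclideanSpace ℝ (Fin d)) (2 * n : ℝ)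
    \ Metric.ball (0 : EuclideanSpace ℝ (Fin d)) (n : ℝ)
  have hDm : MeasurableSet D := measurableSet_ball.diff measurableSet_ball
  set a := fun x => matSup (A x) / (1 + ‖x‖ ^ 2) with ha
  set c := fun x => matSup (C x) ^ 2 * (PhiA (A x))⁻¹ / (1 + ‖x‖ ^ 2) with hc
  set b := fun x => ‖Bb x‖ / (1 + ‖x‖) with hb
  have ha₀ : ∀ x, 0 ≤ a x := fun x => div_nonneg (matSup_nonneg _) (by positivity)
  have hc₀ : ∀ x, 0 ≤ c x := fun x =>
    div_nonneg (mul_nonneg (sq_nonneg _) (inv_nonneg.2 (PhiA_nonneg (hApos x)))) (by positivity)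
  have hb₀ : ∀ x, 0 ≤ b x := fun x => by positivity
  have hint' : Integrable (fun x => a x + c x + b x) μ := by
    simpa only [ha, hc, hb, ← add_div] using hint
  have ham : Measurable a := by
    have : Measurable fun x => matSup (A x) :=
      Measurable.iSup fun i => Measurable.iSup fun j => (hAc i j).abs.measurable
    fun_prop
  have hbm : Measurable b := by fun_prop
  have hai : Integrable a μ := hint'.mono' ham.aestronglyMeasurable <|
    Filter.Eventually.of_forall fun x => by
      rw [Real.norm_of_nonneg (ha₀ x)]
      linarith [hb₀ x, hc₀ x]
  have hbi : Integrable b μ := hint'.mono' hbm.aestronglyMeasurable <|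
    Filter.Eventually.of_forall fun x => by
      rw [Real.norm_of_nonneg (hb₀ x)]
      linarith [ha₀ x, hc₀ x]
  have hci : Integrable c μ := by
    refine ((hint'.sub hai).sub hbi).congr (Filter.Eventually.of_forall fun x => ?_)
    simp only [Pi.sub_apply]
    ring
  obtain ⟨Ku, huL'⟩ := huL
  have huabs : ∀ x, |u x| ≤ (1 : NNReal) := fun x =>
    abs_le.2 ⟨by linarith [(hu01 x).1, NNReal.coe_one], by simpa using (hu01 x).2⟩
  have huuL : ∃ K, LipschitzWith K fun x => u x * u x :=
    ⟨_, lipschitzWith_mul_of_bounded huL' huL' huabs huabs⟩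
  have huus : HasCompactSupport fun x => u x * u x := hus.mul_right
  set v := fun x => u x * u x * h x with hv
  set w := fun x => u x * u x * (h x * h x) with hw
  have hvL : ∃ K, LipschitzWith K v := exists_lipschitzWith_mul_contDiff huuL huus hh1
  have hwL : ∃ K, LipschitzWith K w := exists_lipschitzWith_mul_contDiff huuL huus (hh1.mul hh1)
  have hvs : HasCompactSupport v := huus.mul_right
  have hws : HasCompactSupport w := huus.mul_right
  have hI₁ := integrable_mdot_gradient (μ := μ) (M := fun x => A x + C x)
    (fun i j => (hAc i j).add (hCc i j)) hvL hvs hh1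
  have hI₂ := integrable_inner_gradient_mul hBmeas hBloc hvL hvs hh1.continuous hS
  have hI₃ : Integrable (fun x => v x * h x) μ :=
    (hvL.choose_spec.continuous.mul hh1.continuous).integrable_of_hasCompactSupport hvs.mul_right
  have hI₄ : Integrable (fun x => ⟪Bb x, gradient w x⟫) μ := by
    simpa using integrable_inner_gradient_mul hBmeas hBloc hwL hws (h := fun _ => 1) (S := 1)
      continuous_const (by simp)
  set J := fun x => 1 / 2 * mdot (A x + C x) (gradient v x) (gradient h x)
    + ⟪Bb x, gradient v x⟫ * h x + v x * h x - 1 / 2 * ⟪Bb x, gradient w x⟫ with hJ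
  have hJi : Integrable J μ :=
    (((hI₁.const_mul _).add hI₂).add hI₃).sub (hI₄.const_mul _)
  have hJ₀ : ∫ x, J x ∂μ = 0 := by
    refine (integral_sub (((hI₁.const_mul (1 / 2)).add hI₂).add hI₃)
      (hI₄.const_mul (1 / 2))).trans ?_
    rw [integral_add' ((hI₁.const_mul _).add hI₂) hI₃, integral_add' (hI₁.const_mul _) hI₂,
      integral_const_mul, integral_const_mul, hBdiv w hwL hws, mul_zero, sub_zero]
    exact hres v hvL hvs
  set R := fun x => 16 * d * K ^ 2 * S ^ 2 * a x + 16 * d ^ 2 * K ^ 2 * S ^ 2 * c x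
    + 4 * K * S ^ 2 * b x with hR
  have hRi : Integrable R μ :=
    ((hai.const_mul _).add (hci.const_mul _)).add (hbi.const_mul _)
  have hRint : ∫ x in D, R x ∂μ = 16 * d * K ^ 2 * S ^ 2 * ∫ x in D, a x ∂μ
      + 16 * d ^ 2 * K ^ 2 * S ^ 2 * ∫ x in D, c x ∂μ + 4 * K * S ^ 2 * ∫ x in D, b x ∂μ := by
    refine (integral_add ((hai.const_mul _).add (hci.const_mul _)).integrableOn
      (hbi.const_mul _).integrableOn).trans ?_
    rw [integral_add' (hai.const_mul _).integrableOn (hci.const_mul _).integrableOn,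
      integral_const_mul, integral_const_mul, integral_const_mul]
  have hh2 : IntegrableOn (fun x => h x ^ 2) (Metric.ball 0 n) μ :=
    ((hh1.continuous.pow 2).locallyIntegrable.integrableOn_isCompact
      (isCompact_closedBall 0 (n : ℝ))).mono_set Metric.ball_subset_closedBall
  have hpt : ∀ᵐ x ∂μ, (Metric.ball (0 : EuclideanSpace ℝ (Fin d)) n).indicator
      (fun x => h x ^ 2) x ≤ J x + D.indicator R x := by
    filter_upwards [hac.ae_le huK, hac.ae_le huL'.ae_differentiableAt] with x hxK hxd
    have hgu := hxd.hasGradientAt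
    have hgh := (hh1.differentiable one_ne_zero x).hasGradientAt
    have hgv : gradient v x = u x • (u x • gradient h x + (2 : ℝ) • h x • gradient u x) := by
      rw [((hgu.mul hgu).mul hgh).gradient]
      module
    have hgw : gradient w x = (2 * (u x * h x)) •
        (u x • gradient h x + h x • gradient u x) := by
      rw [((hgu.mul hgu).mul (hgh.mul hgh)).gradient]
      module
    have hSx := hSsq x
    have hB : ⟪Bb x, gradient v x⟫ * h x - 1 / 2 * ⟪Bb x, gradient w x⟫
        = u x * h x ^ 2 * ⟪Bb x, gradient u x⟫ := by
      rw [hgv, hgw]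
      simp only [inner_smul_right, inner_add_right]
      ring
    have hBabs : -(u x * h x ^ 2 * ⟪Bb x, gradient u x⟫) ≤ S ^ 2 * (‖Bb x‖ * ‖gradient u x‖) := by
      have h₁ : |u x * h x ^ 2 * ⟪Bb x, gradient u x⟫|
          ≤ (1 * S ^ 2) * (‖Bb x‖ * ‖gradient u x‖) := by
        rw [abs_mul, abs_mul, abs_sq]
        gcongr
        · exact huabs x
        · exact abs_real_inner_le_norm _ _
      linarith [neg_abs_le (u x * h x ^ 2 * ⟪Bb x, gradient u x⟫)]
    have hM := neg_half_mdot_le (hApos x) (hAsymm x) (hCanti x)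
      (h x • gradient u x) (u x • gradient h x)
    rw [mdot_smul_right, ← mdot_smul_left, ← hgv, norm_smul, Real.norm_eq_abs, mul_pow,
      sq_abs] at hM
    have hind : (Metric.ball (0 : EuclideanSpace ℝ (Fin d)) n).indicator
        (fun x => h x ^ 2) x ≤ v x * h x := by
      by_cases hx : x ∈ Metric.ball (0 : EuclideanSpace ℝ (Fin d)) n
      · simp only [Set.indicator_of_mem hx, hv, hu1 x hx]
        exact le_of_eq (by ring)
      · rw [Set.indicator_of_notMem hx, show v x * h x = (u x * h x) ^ 2 by simp only [hv]; ring]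
        positivity
    suffices hmain : (d * matSup (A x) + d ^ 2 * (matSup (C x) ^ 2 * (PhiA (A x))⁻¹))
        * (h x ^ 2 * ‖gradient u x‖ ^ 2) + S ^ 2 * (‖Bb x‖ * ‖gradient u x‖)
        ≤ D.indicator R x by
      simp only [hJ]
      linarith
    by_cases hx : x ∈ D
    · rw [Set.indicator_of_mem hx]
      have hxr : ‖x‖ < 2 * n := by simpa using hx.1
      have h₁ := sq_div_le_of_norm_lt (K := K) hn1 (norm_nonneg x) hxr
      have h₂ := div_le_of_norm_lt hK.le hn1 (norm_nonneg x) hxr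
      have hnonneg : 0 ≤ d * matSup (A x) + d ^ 2 * (matSup (C x) ^ 2 * (PhiA (A x))⁻¹) := by
        have := matSup_nonneg (A x)
        have := PhiA_nonneg (hApos x)
        positivity
      calc _ ≤ (d * matSup (A x) + d ^ 2 * (matSup (C x) ^ 2 * (PhiA (A x))⁻¹))
            * (S ^ 2 * (16 * K ^ 2 / (1 + ‖x‖ ^ 2)))
            + S ^ 2 * (‖Bb x‖ * (4 * K / (1 + ‖x‖))) := by
            gcongr
            · exact (pow_le_pow_left₀ (norm_nonneg _) hxK 2).trans h₁
            · exact hxK.trans h₂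
        _ = R x := by
            simp only [hR, ha, hc, hb]
            ring
    · rw [Set.indicator_of_notMem hx]
      have hgu0 : gradient u x = 0 := by
        apply gradient_eq_zero_of_mem_Icc hu01
        by_cases hxn : x ∈ Metric.ball (0 : EuclideanSpace ℝ (Fin d)) n
        · exact Or.inr (hu1 x hxn)
        · exact Or.inl (hu0 x fun hx2 => hx ⟨hx2, hxn⟩)
      simp [hgu0]
  calc ∫ x in Metric.ball (0 : EuclideanSpace ℝ (Fin d)) n, h x ^ 2 ∂μ
      = ∫ x, (Metric.ball (0 : EuclideanSpace ℝ (Fin d)) n).indicator (fun x => h x ^ 2) x ∂μ :=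
        (integral_indicator measurableSet_ball).symm
    _ ≤ ∫ x, (J x + D.indicator R x) ∂μ :=
        integral_mono_ae (hh2.integrable_indicator measurableSet_ball)
          (hJi.add (hRi.indicator hDm)) hpt
    _ = _ := by
        rw [integral_add hJi (hRi.indicator hDm), hJ₀, zero_add, integral_indicator hDm, hRint]
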